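/- arXiv:2003.05338 — 2 statements merged into one kernel-verified Lean document; each statement's English description precedes it below -/
import Mathlib

section
/- Let Y be a Polish space and let p₁, p₂, γ₁, γ₂ and ν be pairwise equivalent probability measures on Y such that H(p₁|γ₁) and H(p₂|γ₂) are finite. If there exists no constant α ∈ ℝ such that dp₁/dγ₁ = α · dp₂/dγ₂ holds ν-almost everywhere, then there exist probability measures q₁, q₂ on Y with q₁ + q₂ = p₁ + p₂ and H(p₁|γ₁) + H(p₂|γ₂) > H(q₁|γ₁) + H(q₂|γ₂). -/
open MeasureTheory ProbabilityTheory ENNReal NNReal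

noncomputable section

open scoped Classical in
/-- The relative entropy `H(p|q) = ∫ log (dp/dq) dp` if `p ≪ q` (with value `+∞` if the
integral diverges), and `H(p|q) = +∞` otherwise. -/
noncomputable def relEnt {α : Type*} [MeasurableSpace α] (p q : Measure α) : ℝ≥0∞ :=
  if p ≪ q ∧ Integrable (llr p q) p then ENNReal.ofReal (∫ a, llr p q a ∂p) else ⊤

variable {Y : Type*} [MetricSpace Y] [PolishSpace Y] [MeasurableSpace Y] [BorelSpace Y]

theorem relEnt_ne_top_iff {α : Type*} [MeasurableSpace α] {p q : Measure α} :
    relEnt p q ≠ ⊤ ↔ p ≪ q ∧ Integrable (llr p q) p := by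
  unfold relEnt
  split_ifs with h <;> simp [h]

theorem relEnt_eq_ofReal {α : Type*} [MeasurableSpace α] {p q : Measure α} (h : p ≪ q)
    (hint : Integrable (llr p q) p) : relEnt p q = ENNReal.ofReal (∫ a, llr p q a ∂p) :=
  if_pos ⟨h, hint⟩

theorem integral_llr_nonneg {α : Type*} [MeasurableSpace α] {p q : Measure α}
    [IsProbabilityMeasure p] [IsProbabilityMeasure q] (h : p ≪ q)
    (hint : Integrable (llr p q) p) : 0 ≤ ∫ a, llr p q a ∂p := by
  simpa using InformationTheory.integral_llr_add_sub_measure_univ_nonneg h hint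

theorem isProbabilityMeasure_withDensity_one_add {α : Type*} [MeasurableSpace α] {p : Measure α}
    [IsProbabilityMeasure p] {θ : α → ℝ} (hθ : Integrable θ p) (hpos : ∀ a, 0 ≤ 1 + θ a)
    (hmean : ∫ a, θ a ∂p = 0) :
    IsProbabilityMeasure (p.withDensity fun a => ENNReal.ofReal (1 + θ a)) := by
  constructor
  rw [withDensity_apply _ MeasurableSet.univ, Measure.restrict_univ,
    ← ofReal_integral_eq_lintegral_ofReal (f := fun a => 1 + θ a)
      ((integrable_const 1).add hθ) (ae_of_all _ hpos),
    integral_add (integrable_const 1) hθ, hmean]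
  simp

theorem llr_withDensity_one_add {α : Type*} [MeasurableSpace α] {p q : Measure α}
    [IsFiniteMeasure p] [SigmaFinite q] (h : p ≪ q) {θ : α → ℝ} (hθ : Measurable θ)
    (hpos : ∀ a, 0 < 1 + θ a) :
    llr (p.withDensity fun a => ENNReal.ofReal (1 + θ a)) q =ᵐ[p]
      fun a => Real.log (1 + θ a) + llr p q a := by
  have hm : Measurable fun a => ENNReal.ofReal (1 + θ a) := by fun_prop
  filter_upwards [h.ae_le (Measure.rnDeriv_withDensity_left_of_absolutelyContinuous h hm.aemeasurable),
    Measure.rnDeriv_pos h, h.ae_le (Measure.rnDeriv_lt_top p q)] with a ha h0 htop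
  have hr : 0 < (p.rnDeriv q a).toReal := ENNReal.toReal_pos h0.ne' htop.ne
  rw [llr_def, llr_def]
  simp only
  rw [ha, ENNReal.toReal_mul, ENNReal.toReal_ofReal (hpos a).le,
    Real.log_mul (hpos a).ne' hr.ne']

/-- Perturbing `p` by the bounded, centred factor `1 + θ` changes the relative entropy at first
order by at most `∫ θ log (dp/dq) dp`. -/
theorem integral_llr_withDensity_one_add_le {α : Type*} [MeasurableSpace α] {p q : Measure α}
    [IsProbabilityMeasure p] [SigmaFinite q] (h : p ≪ q) (hint : Integrable (llr p q) p)
    {θ : α → ℝ} (hθ : Measurable θ) (hbd : ∀ a, |θ a| ≤ 1 / 2) (hmean : ∫ a, θ a ∂p = 0) :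
    Integrable (llr (p.withDensity fun a => ENNReal.ofReal (1 + θ a)) q)
        (p.withDensity fun a => ENNReal.ofReal (1 + θ a)) ∧
      ∫ a, llr (p.withDensity fun a => ENNReal.ofReal (1 + θ a)) q a
          ∂(p.withDensity fun a => ENNReal.ofReal (1 + θ a)) ≤
        ∫ a, llr p q a ∂p + ∫ a, θ a * llr p q a ∂p + ∫ a, θ a ^ 2 ∂p := by
  have hpos : ∀ a, 1 / 2 ≤ 1 + θ a := fun a => by linarith [(abs_le.mp (hbd a)).1]
  have hpos' : ∀ a, 0 < 1 + θ a := fun a => by linarith [hpos a]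
  have hm : Measurable fun a => ENNReal.ofReal (1 + θ a) := by fun_prop
  have hbdd : ∀ {f : α → ℝ} (C : ℝ), Measurable f → (∀ a, |f a| ≤ C) → Integrable f p :=
    fun C hf hC => Integrable.of_bound hf.aestronglyMeasurable C (ae_of_all _ hC)
  have hiθ : Integrable θ p := hbdd _ hθ hbd
  have hisq : Integrable (fun a => θ a ^ 2) p := by
    refine hbdd (1 / 4) (by fun_prop) fun a => ?_
    rw [abs_of_nonneg (sq_nonneg _)]
    nlinarith [abs_le.mp (hbd a), (abs_le.mp (hbd a)).1, (abs_le.mp (hbd a)).2]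
  have hupper : ∀ a, (1 + θ a) * Real.log (1 + θ a) ≤ θ a + θ a ^ 2 := fun a => by
    nlinarith [Real.log_le_sub_one_of_pos (hpos' a), hpos' a]
  have hlower : ∀ a, θ a ≤ (1 + θ a) * Real.log (1 + θ a) := fun a => by
    have h1 := mul_le_mul_of_nonneg_left (Real.one_sub_inv_le_log_of_pos (hpos' a)) (hpos' a).le
    rw [mul_sub, mul_inv_cancel₀ (hpos' a).ne'] at h1
    linarith
  have hilog : Integrable (fun a => (1 + θ a) * Real.log (1 + θ a)) p := by
    refine hbdd 1 (by fun_prop) fun a => abs_le.mpr ?_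
    have h1 := abs_le.mp (hbd a)
    constructor
    · linarith [hlower a]
    · nlinarith [hupper a]
  have hiprod : Integrable (fun a => θ a * llr p q a) p :=
    hint.bdd_mul (c := 1 / 2) hθ.aestronglyMeasurable (ae_of_all _ hbd)
  have heq : (fun a => (ENNReal.ofReal (1 + θ a)).toReal •
        llr (p.withDensity fun a => ENNReal.ofReal (1 + θ a)) q a) =ᵐ[p]
      fun a => (1 + θ a) * Real.log (1 + θ a) + (llr p q a + θ a * llr p q a) := by
    filter_upwards [llr_withDensity_one_add h hθ hpos'] with a ha
    rw [ha, ENNReal.toReal_ofReal (hpos' a).le, smul_eq_mul]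
    ring
  constructor
  · rw [integrable_withDensity_iff_integrable_smul' hm (by simp), integrable_congr heq]
    exact hilog.add (hint.add hiprod)
  · rw [integral_withDensity_eq_integral_toReal_smul hm (by simp), integral_congr_ae heq,
      integral_add hilog (g := fun a => llr p q a + θ a * llr p q a) (hint.add hiprod),
      integral_add hint hiprod]
    have h1 : ∫ a, (1 + θ a) * Real.log (1 + θ a) ∂p ≤ ∫ a, θ a + θ a ^ 2 ∂p :=
      integral_mono hilog (hiθ.add hisq) hupper
    rw [integral_add hiθ hisq, hmean] at h1
    linarith

/-- A function `L` that is not almost everywhere constant can be separated from the constants by a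
bounded function `φ`, with respect to the weight `k`. -/
theorem exists_bounded_centered_integral_neg {α : Type*} [MeasurableSpace α] {p : Measure α}
    [IsProbabilityMeasure p] {k L : α → ℝ} (hk : Measurable k) (hL : Measurable L)
    (hk_bd : ∀ a, |k a| ≤ 1) (hk_pos : ∀ᵐ a ∂p, 0 < k a)
    (hkL : Integrable (fun a => k a * L a) p) (hconst : ¬ ∃ c : ℝ, ∀ᵐ a ∂p, L a = c) :
    ∃ φ : α → ℝ, Measurable φ ∧ (∀ a, |φ a| ≤ 1 / 2) ∧ ∫ a, φ a * k a ∂p = 0 ∧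
      ∫ a, φ a * (k a * L a) ∂p < 0 := by
  have hden : ∀ a, 0 < 1 + |L a| := fun a => by positivity
  set ψ : α → ℝ := fun a => (1 + |L a|)⁻¹ with hψ
  have hψm : Measurable ψ := by fun_prop
  have hψ_pos : ∀ a, 0 < ψ a := fun a => inv_pos.mpr (hden a)
  have hψ_le : ∀ a, ψ a ≤ 1 := fun a => inv_le_one_of_one_le₀ (by linarith [abs_nonneg (L a)])
  have hψ_bd : ∀ a, |ψ a| ≤ 1 := fun a => by rw [abs_of_pos (hψ_pos a)]; exact hψ_le a
  have hψL_bd : ∀ a, |ψ a * L a| ≤ 1 := fun a => by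
    rw [abs_mul, abs_of_pos (hψ_pos a), hψ, inv_mul_le_iff₀ (hden a)]
    linarith
  have hik : Integrable k p :=
    Integrable.of_bound hk.aestronglyMeasurable 1 (ae_of_all _ hk_bd)
  have hiψk : Integrable (fun a => ψ a * k a) p :=
    hik.bdd_mul (c := 1) hψm.aestronglyMeasurable (ae_of_all _ hψ_bd)
  have hiψLk : Integrable (fun a => ψ a * L a * k a) p :=
    hik.bdd_mul (c := 1) (hψm.mul hL).aestronglyMeasurable (ae_of_all _ hψL_bd)
  have hN : 0 < ∫ a, ψ a * k a ∂p := by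
    have hnn : 0 ≤ᵐ[p] fun a => ψ a * k a := by
      filter_upwards [hk_pos] with a ha using (mul_pos (hψ_pos a) ha).le
    refine lt_of_le_of_ne (integral_nonneg_of_ae hnn) fun h0 => ?_
    have h1 := (integral_eq_zero_iff_of_nonneg_ae hnn hiψk).mp h0.symm
    obtain ⟨a, ha, hka⟩ := (h1.and hk_pos).exists
    exact (mul_pos (hψ_pos a) hka).ne' ha
  obtain ⟨c, hc⟩ : ∃ c : ℝ, c * ∫ a, ψ a * k a ∂p = ∫ a, ψ a * L a * k a ∂p :=
    ⟨_, div_mul_cancel₀ _ hN.ne'⟩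
  set K : ℝ := (2 * (|c| + 1))⁻¹ with hKdef
  have hKpos : 0 < K := by positivity
  set φ : α → ℝ := fun a => K * ((c - L a) * ψ a) with hφ
  have hφm : Measurable φ := by fun_prop
  have hφ_bd : ∀ a, |φ a| ≤ 1 / 2 := fun a => by
    have h1 : |(c - L a) * ψ a| ≤ |c| + 1 := by
      rw [sub_mul]
      refine (abs_sub _ _).trans (add_le_add ?_ ?_)
      · rw [abs_mul]; exact mul_le_of_le_one_right (abs_nonneg _) (hψ_bd a)
      · rw [mul_comm]; exact hψL_bd a
    rw [hφ]
    simp only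
    rw [abs_mul, abs_of_pos hKpos, hKdef, inv_mul_le_iff₀ (by positivity)]
    linarith
  have hφk : ∫ a, φ a * k a ∂p = 0 := by
    have : (fun a => φ a * k a) = fun a => K * (c * (ψ a * k a) - ψ a * L a * k a) := by
      funext a; simp only [hφ]; ring
    rw [this, integral_const_mul, integral_sub (hiψk.const_mul c) hiψLk, integral_const_mul, hc,
      sub_self, mul_zero]
  have hiφk : Integrable (fun a => φ a * k a) p :=
    hik.bdd_mul (c := 1 / 2) hφm.aestronglyMeasurable (ae_of_all _ hφ_bd)
  have hiφkL : Integrable (fun a => φ a * (k a * L a)) p :=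
    hkL.bdd_mul (c := 1 / 2) hφm.aestronglyMeasurable (ae_of_all _ hφ_bd)
  refine ⟨φ, hφm, hφ_bd, hφk, ?_⟩
  have hG : (fun a => c * (φ a * k a) - φ a * (k a * L a)) =
      fun a => K * ψ a * k a * (c - L a) ^ 2 := by
    funext a; simp only [hφ]; ring
  have hGi : Integrable (fun a => c * (φ a * k a) - φ a * (k a * L a)) p :=
    (hiφk.const_mul c).sub hiφkL
  have hGint : ∫ a, (c * (φ a * k a) - φ a * (k a * L a)) ∂p =
      -∫ a, φ a * (k a * L a) ∂p := by
    rw [integral_sub (hiφk.const_mul c) hiφkL, integral_const_mul, hφk]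
    ring
  have hGnn : 0 ≤ᵐ[p] fun a => K * ψ a * k a * (c - L a) ^ 2 := by
    filter_upwards [hk_pos] with a ha
    exact mul_nonneg (mul_pos (mul_pos hKpos (hψ_pos a)) ha).le (sq_nonneg _)
  rw [hG] at hGi hGint
  have hge : 0 ≤ ∫ a, K * ψ a * k a * (c - L a) ^ 2 ∂p := integral_nonneg_of_ae hGnn
  refine lt_of_le_of_ne (by linarith) fun h0 => hconst ⟨c, ?_⟩
  rw [h0, neg_zero, integral_eq_zero_iff_of_nonneg_ae hGnn hGi] at hGint
  filter_upwards [hGint, hk_pos] with a ha hka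
  have h1 : (c - L a) ^ 2 = 0 :=
    (mul_eq_zero.mp ha).resolve_left (mul_pos (mul_pos hKpos (hψ_pos a)) hka).ne'
  linarith [pow_eq_zero_iff (two_ne_zero) |>.mp h1]

/-- Log-likelihood ratios that differ by a constant come from proportional densities. -/
theorem rnDeriv_eq_const_mul_of_llr_sub_eq {α : Type*} [MeasurableSpace α]
    {p p₁ p₂ q₁ q₂ : Measure α} [SigmaFinite p₁] [SigmaFinite p₂] [SigmaFinite q₁]
    [SigmaFinite q₂] (h₁ : p ≪ p₁) (h₂ : p ≪ p₂) (h₁' : p₁ ≪ q₁) (h₂' : p₂ ≪ q₂) {c : ℝ}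
    (hc : ∀ᵐ a ∂p, llr p₁ q₁ a - llr p₂ q₂ a = c) :
    ∀ᵐ a ∂p, p₁.rnDeriv q₁ a = ENNReal.ofReal (Real.exp c) * p₂.rnDeriv q₂ a := by
  filter_upwards [hc, h₁.ae_le (exp_llr_of_ac p₁ q₁ h₁'), h₂.ae_le (exp_llr_of_ac p₂ q₂ h₂'),
    (h₁.trans h₁').ae_le (Measure.rnDeriv_lt_top p₁ q₁),
    (h₂.trans h₂').ae_le (Measure.rnDeriv_lt_top p₂ q₂)] with a ha h1 h2 h3 h4
  rw [← ENNReal.ofReal_toReal h3.ne, ← ENNReal.ofReal_toReal h4.ne, ← h1, ← h2,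
    ← ENNReal.ofReal_mul (Real.exp_pos c).le, ← Real.exp_add, ← ha]
  ring_nf

theorem withDensity_add_withDensity_eq {α : Type*} [MeasurableSpace α] {p₁ p₂ : Measure α}
    [IsFiniteMeasure p₁] [IsFiniteMeasure p₂] (h : p₂ ≪ p₁) {θ₁ θ₂ : α → ℝ}
    (hθ₁ : Measurable θ₁) (hθ₂ : Measurable θ₂) (hpos₁ : ∀ a, 0 ≤ 1 + θ₁ a)
    (hpos₂ : ∀ a, 0 ≤ 1 + θ₂ a)
    (hbal : ∀ a, θ₁ a + (p₂.rnDeriv p₁ a).toReal * θ₂ a = 0) :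
    (p₁.withDensity fun a => ENNReal.ofReal (1 + θ₁ a)) +
      (p₂.withDensity fun a => ENNReal.ofReal (1 + θ₂ a)) = p₁ + p₂ := by
  have hm₁ : Measurable fun a => ENNReal.ofReal (1 + θ₁ a) := by fun_prop
  have hm₂ : Measurable fun a => ENNReal.ofReal (1 + θ₂ a) := by fun_prop
  have hw := Measure.measurable_rnDeriv p₂ p₁
  have h2 : p₁.withDensity (p₂.rnDeriv p₁) = p₂ := Measure.withDensity_rnDeriv_eq _ _ h
  have h1 : p₂.withDensity (fun a => ENNReal.ofReal (1 + θ₂ a)) =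
      p₁.withDensity (p₂.rnDeriv p₁ * fun a => ENNReal.ofReal (1 + θ₂ a)) := by
    rw [withDensity_mul _ hw hm₂, h2]
  have h3 : p₁ + p₂ = p₁.withDensity (1 + p₂.rnDeriv p₁) := by
    rw [withDensity_add_left measurable_one, withDensity_one, h2]
  rw [h1, ← withDensity_add_left hm₁, h3]
  refine withDensity_congr_ae ?_
  filter_upwards [Measure.rnDeriv_lt_top p₂ p₁] with a ha
  have hw0 : 0 ≤ (p₂.rnDeriv p₁ a).toReal := ENNReal.toReal_nonneg
  simp only [Pi.add_apply, Pi.mul_apply, Pi.one_apply]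
  rw [← ENNReal.ofReal_toReal ha.ne, ← ENNReal.ofReal_mul hw0,
    ← ENNReal.ofReal_add (hpos₁ a) (mul_nonneg hw0 (hpos₂ a)), ← ENNReal.ofReal_one,
    ← ENNReal.ofReal_add zero_le_one hw0]
  congr 1
  linarith [hbal a]

/-- Strict improvement on an arbitrary measurable space, in terms of log-likelihood ratios. -/
theorem exists_relEnt_add_lt {α : Type*} [MeasurableSpace α] {p₁ p₂ γ₁ γ₂ : Measure α}
    [IsProbabilityMeasure p₁] [IsProbabilityMeasure p₂] [IsProbabilityMeasure γ₁]
    [IsProbabilityMeasure γ₂] (h₂₁ : p₂ ≪ p₁) (h₁₂ : p₁ ≪ p₂)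
    (hH₁ : relEnt p₁ γ₁ ≠ ⊤) (hH₂ : relEnt p₂ γ₂ ≠ ⊤)
    (hconst : ¬ ∃ c : ℝ, ∀ᵐ a ∂p₁, llr p₁ γ₁ a - llr p₂ γ₂ a = c) :
    ∃ q₁ q₂ : Measure α, IsProbabilityMeasure q₁ ∧ IsProbabilityMeasure q₂ ∧
      q₁ + q₂ = p₁ + p₂ ∧ relEnt q₁ γ₁ + relEnt q₂ γ₂ < relEnt p₁ γ₁ + relEnt p₂ γ₂ := by
  obtain ⟨hac₁, hint₁⟩ := relEnt_ne_top_iff.mp hH₁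
  obtain ⟨hac₂, hint₂⟩ := relEnt_ne_top_iff.mp hH₂
  set w : α → ℝ := fun a => (p₂.rnDeriv p₁ a).toReal with hw
  have hwm : Measurable w := (Measure.measurable_rnDeriv p₂ p₁).ennreal_toReal
  have hw0 : ∀ a, 0 ≤ w a := fun a => ENNReal.toReal_nonneg
  have hwpos : ∀ᵐ a ∂p₁, 0 < w a := by
    filter_upwards [Measure.rnDeriv_pos' h₁₂, Measure.rnDeriv_lt_top p₂ p₁] with a ha ha'
      using ENNReal.toReal_pos ha.ne' ha'.ne
  set j : α → ℝ := fun a => (1 + w a)⁻¹ with hj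
  have hden : ∀ a, 0 < 1 + w a := fun a => by linarith [hw0 a]
  have hjm : Measurable j := by fun_prop
  have hj_pos : ∀ a, 0 < j a := fun a => inv_pos.mpr (hden a)
  have hj_bd : ∀ a, |j a| ≤ 1 := fun a => by
    rw [abs_of_pos (hj_pos a)]
    exact inv_le_one_of_one_le₀ (by linarith [hw0 a])
  have hk_bd : ∀ a, |w a * j a| ≤ 1 := fun a => by
    rw [abs_of_nonneg (mul_nonneg (hw0 a) (hj_pos a).le), hj, ← div_eq_mul_inv,
      div_le_one (hden a)]
    linarith
  have hl₁ := measurable_llr p₁ γ₁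
  have hl₂ := measurable_llr p₂ γ₂
  have hi₁ : Integrable (fun a => w a * j a * llr p₁ γ₁ a) p₁ :=
    hint₁.bdd_mul (c := 1) (hwm.mul hjm).aestronglyMeasurable (ae_of_all _ hk_bd)
  have hi₂ : Integrable (fun a => w a * j a * llr p₂ γ₂ a) p₁ := by
    have h1 : Integrable (fun a => w a * llr p₂ γ₂ a) p₁ :=
      (integrable_rnDeriv_smul_iff h₂₁).mpr hint₂
    refine (h1.bdd_mul (c := 1) hjm.aestronglyMeasurable (ae_of_all _ hj_bd)).congr
      (ae_of_all _ fun a => ?_)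
    simp only
    ring
  obtain ⟨φ, hφm, hφ_bd, hφ0, hφneg⟩ := exists_bounded_centered_integral_neg (p := p₁)
    (hwm.mul hjm) (hl₁.sub hl₂) hk_bd
    (by filter_upwards [hwpos] with a ha using mul_pos ha (hj_pos a))
    ((hi₁.sub hi₂).congr (ae_of_all _ fun a => (mul_sub _ _ _).symm)) hconst
  simp only [Pi.mul_apply, Pi.sub_apply] at hφ0 hφneg
  set D : ℝ := ∫ a, φ a * (w a * j a * (llr p₁ γ₁ a - llr p₂ γ₂ a)) ∂p₁ with hD
  obtain ⟨ε, hε, hε1, hεD⟩ : ∃ ε : ℝ, 0 < ε ∧ ε ≤ 1 ∧ ε < -D :=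
    ⟨min 1 (-D / 2), lt_min one_pos (by linarith), min_le_left _ _,
      (min_le_right _ _).trans_lt (by linarith)⟩
  have hbd : ∀ {u : α → ℝ}, (∀ a, |u a| ≤ 1) → ∀ a, |ε * (φ a * u a)| ≤ ε / 2 := fun hu a => by
    rw [abs_mul, abs_of_pos hε, abs_mul]
    nlinarith [mul_le_mul (hφ_bd a) (hu a) (abs_nonneg _) (by norm_num)]
  set θ₁ : α → ℝ := fun a => ε * (φ a * (w a * j a)) with hθ₁
  set θ₂ : α → ℝ := fun a => -(ε * (φ a * j a)) with hθ₂
  have hθ₁m : Measurable θ₁ := by fun_prop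
  have hθ₂m : Measurable θ₂ := by fun_prop
  have hθ₁ε : ∀ a, |θ₁ a| ≤ ε / 2 := hbd hk_bd
  have hθ₂ε : ∀ a, |θ₂ a| ≤ ε / 2 := fun a => by rw [hθ₂, abs_neg]; exact hbd hj_bd a
  have hθ₁_bd : ∀ a, |θ₁ a| ≤ 1 / 2 := fun a => (hθ₁ε a).trans (by linarith)
  have hθ₂_bd : ∀ a, |θ₂ a| ≤ 1 / 2 := fun a => (hθ₂ε a).trans (by linarith)
  have hpos₁ : ∀ a, 0 ≤ 1 + θ₁ a := fun a => by linarith [(abs_le.mp (hθ₁_bd a)).1]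
  have hpos₂ : ∀ a, 0 ≤ 1 + θ₂ a := fun a => by linarith [(abs_le.mp (hθ₂_bd a)).1]
  have hmean₁ : ∫ a, θ₁ a ∂p₁ = 0 := by rw [integral_const_mul, hφ0, mul_zero]
  have hmean₂ : ∫ a, θ₂ a ∂p₂ = 0 := by
    rw [← integral_rnDeriv_smul h₂₁, ← neg_zero, ← hmean₁, ← integral_neg]
    refine integral_congr_ae (ae_of_all _ fun a => ?_)
    simp only [smul_eq_mul, hθ₁, hθ₂, hw]
    ring
  have hsq : ∀ (p : Measure α) [IsProbabilityMeasure p] {θ : α → ℝ},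
      (∀ a, |θ a| ≤ ε / 2) → ∫ a, θ a ^ 2 ∂p ≤ ε ^ 2 / 4 := fun p _ θ hθ => by
    have h1 : ∫ a, θ a ^ 2 ∂p ≤ ∫ _, ε ^ 2 / 4 ∂p :=
      integral_mono_of_nonneg (ae_of_all _ fun a => sq_nonneg _) (integrable_const _)
        (ae_of_all _ fun a => by
          have h2 := pow_le_pow_left₀ (abs_nonneg _) (hθ a) 2
          rw [sq_abs] at h2
          simp only
          linarith)
    simpa using h1
  have hcross : ∫ a, θ₁ a * llr p₁ γ₁ a ∂p₁ + ∫ a, θ₂ a * llr p₂ γ₂ a ∂p₂ = ε * D := by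
    have hiφ : ∀ {u : α → ℝ}, Integrable u p₁ → Integrable (fun a => φ a * u a) p₁ := fun hu =>
      hu.bdd_mul (c := 1 / 2) hφm.aestronglyMeasurable (ae_of_all _ hφ_bd)
    have e₁ : ∫ a, θ₁ a * llr p₁ γ₁ a ∂p₁ = ε * ∫ a, φ a * (w a * j a * llr p₁ γ₁ a) ∂p₁ := by
      rw [← integral_const_mul]
      refine integral_congr_ae (ae_of_all _ fun a => ?_)
      simp only [hθ₁]
      ring
    have e₂ : ∫ a, θ₂ a * llr p₂ γ₂ a ∂p₂ =
        -ε * ∫ a, φ a * (w a * j a * llr p₂ γ₂ a) ∂p₁ := by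
      rw [← integral_rnDeriv_smul h₂₁, ← integral_const_mul]
      refine integral_congr_ae (ae_of_all _ fun a => ?_)
      simp only [smul_eq_mul, hθ₂, hw]
      ring
    have e₃ : D = ∫ a, φ a * (w a * j a * llr p₁ γ₁ a) ∂p₁ -
        ∫ a, φ a * (w a * j a * llr p₂ γ₂ a) ∂p₁ := by
      rw [← integral_sub (hiφ hi₁) (hiφ hi₂), hD]
      refine integral_congr_ae (ae_of_all _ fun a => ?_)
      simp only
      ring
    rw [e₁, e₂, e₃]
    ring
  obtain ⟨hqint₁, hle₁⟩ :=
    integral_llr_withDensity_one_add_le hac₁ hint₁ hθ₁m hθ₁_bd hmean₁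
  obtain ⟨hqint₂, hle₂⟩ :=
    integral_llr_withDensity_one_add_le hac₂ hint₂ hθ₂m hθ₂_bd hmean₂
  have hP₁ := isProbabilityMeasure_withDensity_one_add
    (Integrable.of_bound hθ₁m.aestronglyMeasurable (1 / 2) (ae_of_all p₁ hθ₁_bd)) hpos₁ hmean₁
  have hP₂ := isProbabilityMeasure_withDensity_one_add
    (Integrable.of_bound hθ₂m.aestronglyMeasurable (1 / 2) (ae_of_all p₂ hθ₂_bd)) hpos₂ hmean₂
  have hqac₁ := (withDensity_absolutelyContinuous p₁ fun a => ENNReal.ofReal (1 + θ₁ a)).trans hac₁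
  have hqac₂ := (withDensity_absolutelyContinuous p₂ fun a => ENNReal.ofReal (1 + θ₂ a)).trans hac₂
  refine ⟨_, _, hP₁, hP₂, withDensity_add_withDensity_eq h₂₁ hθ₁m hθ₂m hpos₁ hpos₂ fun a => ?_, ?_⟩
  · simp only [hθ₁, hθ₂, hw]
    ring
  have hn₁ := integral_llr_nonneg hqac₁ hqint₁
  have hn₂ := integral_llr_nonneg hqac₂ hqint₂
  have hs₁ := hsq p₁ hθ₁ε
  have hs₂ := hsq p₂ hθ₂ε
  have hlt : ε * D + ε ^ 2 < 0 := by nlinarith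
  rw [relEnt_eq_ofReal hac₁ hint₁, relEnt_eq_ofReal hac₂ hint₂, relEnt_eq_ofReal hqac₁ hqint₁,
    relEnt_eq_ofReal hqac₂ hqint₂, ← ENNReal.ofReal_add hn₁ hn₂,
    ← ENNReal.ofReal_add (integral_llr_nonneg hac₁ hint₁) (integral_llr_nonneg hac₂ hint₂),
    ENNReal.ofReal_lt_ofReal_iff_of_nonneg (add_nonneg hn₁ hn₂)]
  nlinarith [sq_nonneg ε]

/-- If the densities `dp₁/dγ₁` and `dp₂/dγ₂` are not proportional, then the pair `(p₁, p₂)`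
can be strictly improved in the two-point entropic minimization problem (Lemma 4.2). -/
theorem entropic_strict_improvement
    (p₁ p₂ γ₁ γ₂ ν : ProbabilityMeasure Y)
    (hp₁ : (p₁ : Measure Y) ≪ (ν : Measure Y)) (hp₁' : (ν : Measure Y) ≪ (p₁ : Measure Y))
    (hp₂ : (p₂ : Measure Y) ≪ (ν : Measure Y)) (hp₂' : (ν : Measure Y) ≪ (p₂ : Measure Y))
    (hγ₁ : (γ₁ : Measure Y) ≪ (ν : Measure Y)) (hγ₁' : (ν : Measure Y) ≪ (γ₁ : Measure Y))
    (hγ₂ : (γ₂ : Measure Y) ≪ (ν : Measure Y)) (hγ₂' : (ν : Measure Y) ≪ (γ₂ : Measure Y))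
    (hH₁ : relEnt (p₁ : Measure Y) (γ₁ : Measure Y) ≠ ⊤)
    (hH₂ : relEnt (p₂ : Measure Y) (γ₂ : Measure Y) ≠ ⊤)
    (hnotprop : ¬ ∃ α : ℝ,
      (fun y => (p₁ : Measure Y).rnDeriv (γ₁ : Measure Y) y) =ᵐ[(ν : Measure Y)]
        (fun y => ENNReal.ofReal α * (p₂ : Measure Y).rnDeriv (γ₂ : Measure Y) y)) :
    ∃ q₁ q₂ : ProbabilityMeasure Y,
      (q₁ : Measure Y) + (q₂ : Measure Y) = (p₁ : Measure Y) + (p₂ : Measure Y) ∧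
      relEnt (q₁ : Measure Y) (γ₁ : Measure Y) + relEnt (q₂ : Measure Y) (γ₂ : Measure Y) <
        relEnt (p₁ : Measure Y) (γ₁ : Measure Y) + relEnt (p₂ : Measure Y) (γ₂ : Measure Y) := by
  have hconst : ¬ ∃ c : ℝ, ∀ᵐ a ∂(p₁ : Measure Y),
      llr (p₁ : Measure Y) (γ₁ : Measure Y) a - llr (p₂ : Measure Y) (γ₂ : Measure Y) a = c := by
    rintro ⟨c, hc⟩
    exact hnotprop ⟨Real.exp c, hp₁'.ae_le (rnDeriv_eq_const_mul_of_llr_sub_eq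
      Measure.AbsolutelyContinuous.rfl (hp₁.trans hp₂') (hp₁.trans hγ₁') (hp₂.trans hγ₂') hc)⟩
  obtain ⟨q₁, q₂, hq₁, hq₂, hsum, hlt⟩ :=
    exists_relEnt_add_lt (hp₂.trans hp₁') (hp₁.trans hp₂') hH₁ hH₂ hconst
  exact ⟨⟨q₁, hq₁⟩, ⟨q₂, hq₂⟩, hsum, hlt⟩

end
end

section
/- Let X and Y be Polish spaces, μ ∈ P(X), ν ∈ P(Y), and let γ ∈ P(X×Y) be equivalent to μ⊗ν. Assume inf_{π ∈ Π(μ,ν)} H(π|γ) < ∞. Then a coupling π* ∈ Π(μ,ν) minimizes H(π|γ) over Π(μ,ν) if and only if H(π*|γ) < ∞ and there exist measurable functions f : X → ℝ and g : Y → ℝ such that dπ*/dγ(x,y) = f(x)·g(y) for γ-almost every (x,y). -/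
open MeasureTheory ProbabilityTheory ENNReal NNReal

noncomputable section

variable {X Y : Type*} [MetricSpace X] [PolishSpace X] [MeasurableSpace X] [BorelSpace X]
  [MetricSpace Y] [PolishSpace Y] [MeasurableSpace Y] [BorelSpace Y]

/-- `π` is a coupling of `μ` and `ν`. -/
def IsCoupling (μ : ProbabilityMeasure X) (ν : ProbabilityMeasure Y)
    (π : ProbabilityMeasure (X × Y)) : Prop :=
  (π : Measure (X × Y)).map Prod.fst = (μ : Measure X) ∧
    (π : Measure (X × Y)).map Prod.snd = (ν : Measure Y)

open InformationTheory Filter Topology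

section Entropy

variable {α : Type*} [MeasurableSpace α]

lemma relEnt_eq_klDiv (p q : Measure α) [IsProbabilityMeasure p] [IsProbabilityMeasure q] :
    relEnt p q = klDiv p q := by
  rw [relEnt, klDiv_def]
  simp

/-- Tangent line inequality for the convex function `klFun`. -/
lemma klFun_add_mul_log_le {a b : ℝ} (ha : 0 ≤ a) (hb : 0 < b) :
    klFun b + (a - b) * Real.log b ≤ klFun a := by
  rcases ha.eq_or_lt with rfl | ha
  · simp only [klFun_apply]
    nlinarith
  · have h := Real.log_le_sub_one_of_pos (div_pos hb ha)
    rw [Real.log_div hb.ne' ha.ne'] at h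
    have h2 := mul_le_mul_of_nonneg_left h ha.le
    have h3 : a * (b / a - 1) = b - a := by field_simp
    simp only [klFun_apply]
    nlinarith

lemma integrable_klFun_of_relEnt_ne_top {p q : Measure α} [IsProbabilityMeasure p]
    [IsProbabilityMeasure q] (h : relEnt p q ≠ ⊤) :
    p ≪ q ∧ Integrable (llr p q) p ∧ Integrable (fun x ↦ klFun (p.rnDeriv q x).toReal) q ∧
      relEnt p q = ENNReal.ofReal (∫ x, klFun (p.rnDeriv q x).toReal ∂q) := by
  rw [relEnt_eq_klDiv] at h ⊢
  obtain ⟨h1, h2⟩ := klDiv_ne_top_iff.1 h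
  exact ⟨h1, h2, (integrable_klFun_rnDeriv_iff h1).2 h2, by
    rw [klDiv_eq_integral_klFun, if_pos ⟨h1, h2⟩]⟩

/-- A finite measure dominated by a multiple of `γ` has a density with the same bound. -/
lemma exists_density_of_le_smul {σ γ : Measure α} [IsFiniteMeasure σ] [IsFiniteMeasure γ] {c : ℝ}
    (hc : 0 ≤ c) (hσ : σ ≤ ENNReal.ofReal c • γ) :
    ∃ h : α → ℝ, Measurable h ∧ (∀ z, 0 ≤ h z) ∧ (∀ z, h z ≤ c) ∧
      σ = γ.withDensity (fun z ↦ ENNReal.ofReal (h z)) := by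
  have hac : σ ≪ γ := (Measure.absolutelyContinuous_of_le hσ).trans
    Measure.smul_absolutelyContinuous
  have hle : σ.rnDeriv γ ≤ᵐ[γ] fun _ ↦ ENNReal.ofReal c := by
    refine ae_le_of_forall_setLIntegral_le_of_sigmaFinite (σ.measurable_rnDeriv γ) fun s _ _ ↦ ?_
    rw [setLIntegral_const]
    exact (Measure.setLIntegral_rnDeriv_le s).trans (hσ s)
  refine ⟨fun z ↦ min c (σ.rnDeriv γ z).toReal, by fun_prop, fun z ↦ le_min hc (by simp),
    fun z ↦ min_le_left _ _, ?_⟩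
  conv_lhs => rw [← Measure.withDensity_rnDeriv_eq σ γ hac]
  refine withDensity_congr_ae ?_
  filter_upwards [hle] with z hz
  have hz' : (σ.rnDeriv γ z).toReal ≤ c := ENNReal.toReal_le_of_le_ofReal hc hz
  rw [min_eq_right hz', ENNReal.ofReal_toReal (hz.trans_lt ENNReal.ofReal_lt_top).ne]

lemma integral_withDensity_ofReal {γ : Measure α} {h : α → ℝ} (hm : Measurable h)
    (h0 : ∀ z, 0 ≤ h z) (u : α → ℝ) :
    ∫ z, u z ∂(γ.withDensity fun z ↦ ENNReal.ofReal (h z)) = ∫ z, h z * u z ∂γ := by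
  rw [integral_withDensity_eq_integral_toReal_smul (by fun_prop) (by simp)]
  simp [ENNReal.toReal_ofReal, h0]

lemma integrable_withDensity_ofReal_iff {γ : Measure α} {h : α → ℝ} (hm : Measurable h)
    (h0 : ∀ z, 0 ≤ h z) (u : α → ℝ) :
    Integrable u (γ.withDensity fun z ↦ ENNReal.ofReal (h z)) ↔
      Integrable (fun z ↦ h z * u z) γ := by
  rw [integrable_withDensity_iff_integrable_smul' (by fun_prop) (by simp)]
  simp [ENNReal.toReal_ofReal, h0]

end Entropy

section Truncation

lemma abs_clamp_add_clamp_le (a b c : ℝ) (hc : 0 ≤ c) :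
    |max (-c) (min a c) + max (-c) (min b c)| ≤ |a + b| ∧
      max (max (-c) (min a c) + max (-c) (min b c)) 0 ≤ max (a + b) 0 := by
  rcases abs_cases (a + b) with h | h <;>
  rcases abs_cases (max (-c) (min a c) + max (-c) (min b c)) with h' | h' <;>
  rcases max_cases (-c) (min a c) with h1 | h1 <;>
  rcases max_cases (-c) (min b c) with h2 | h2 <;>
  rcases min_cases a c with h3 | h3 <;>
  rcases min_cases b c with h4 | h4 <;>
  refine ⟨by linarith, max_le ?_ (le_max_right _ _)⟩ <;>
  first
  | (refine le_max_of_le_left ?_; linarith)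
  | (refine le_max_of_le_right ?_; linarith)

variable {α β : Type*} [MeasurableSpace α] [MeasurableSpace β]

/-- If `φ ⊕ ψ` is integrable for `p` and its positive part is integrable for a measure `q` with the
same marginals, then `φ ⊕ ψ` is integrable for `q` with the same integral. -/
lemma integral_add_eq_of_map_eq {p q : Measure (α × β)} [IsProbabilityMeasure p]
    [IsProbabilityMeasure q] (h₁ : p.map Prod.fst = q.map Prod.fst)
    (h₂ : p.map Prod.snd = q.map Prod.snd) {φ : α → ℝ} {ψ : β → ℝ} (hφ : Measurable φ)
    (hψ : Measurable ψ) (hp : Integrable (fun z ↦ φ z.1 + ψ z.2) p)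
    (hq : Integrable (fun z ↦ max (φ z.1 + ψ z.2) 0) q) :
    Integrable (fun z ↦ φ z.1 + ψ z.2) q ∧
      ∫ z, φ z.1 + ψ z.2 ∂q = ∫ z, φ z.1 + ψ z.2 ∂p := by
  let T : ℕ → ℝ → ℝ := fun n a ↦ max (-(n : ℝ)) (min a n)
  have hTm (n : ℕ) : Measurable (T n) := by fun_prop
  have hTb (n : ℕ) (a : ℝ) : ‖T n a‖ ≤ n := by
    have : (0 : ℝ) ≤ n := n.cast_nonneg
    rw [Real.norm_eq_abs, abs_le]
    exact ⟨le_max_left _ _, max_le (by linarith) (min_le_right _ _)⟩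
  have hTlim (a : ℝ) : Tendsto (fun n ↦ T n a) atTop (𝓝 a) := by
    obtain ⟨N, hN⟩ := exists_nat_ge |a|
    refine tendsto_const_nhds.congr' ?_
    filter_upwards [eventually_ge_atTop N] with n hn
    have : |a| ≤ n := hN.trans (by exact_mod_cast hn)
    rw [abs_le] at this
    simp only [T]
    rw [min_eq_left this.2, max_eq_right this.1]
  let S : ℕ → α × β → ℝ := fun n z ↦ T n (φ z.1) + T n (ψ z.2)
  have hSm (n : ℕ) : Measurable (S n) := by fun_prop
  have hSlim (z : α × β) : Tendsto (fun n ↦ S n z) atTop (𝓝 (φ z.1 + ψ z.2)) :=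
    (hTlim _).add (hTlim _)
  have hSle (n : ℕ) (z : α × β) := abs_clamp_add_clamp_le (φ z.1) (ψ z.2) n n.cast_nonneg
  have hT₁ (n : ℕ) (m : Measure (α × β)) [IsProbabilityMeasure m] :
      Integrable (fun z ↦ T n (φ z.1)) m :=
    Integrable.of_bound ((hTm n).comp (hφ.comp measurable_fst)).aestronglyMeasurable n
      (ae_of_all _ fun z ↦ hTb n _)
  have hT₂ (n : ℕ) (m : Measure (α × β)) [IsProbabilityMeasure m] :
      Integrable (fun z ↦ T n (ψ z.2)) m :=
    Integrable.of_bound ((hTm n).comp (hψ.comp measurable_snd)).aestronglyMeasurable n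
      (ae_of_all _ fun z ↦ hTb n _)
  have hSi (n : ℕ) (m : Measure (α × β)) [IsProbabilityMeasure m] : Integrable (S n) m :=
    (hT₁ n m).add (hT₂ n m)
  have hSeq (n : ℕ) : ∫ z, S n z ∂q = ∫ z, S n z ∂p := by
    have aux (m : Measure (α × β)) [IsProbabilityMeasure m] : ∫ z, S n z ∂m =
        ∫ x, T n (φ x) ∂(m.map Prod.fst) + ∫ y, T n (ψ y) ∂(m.map Prod.snd) := by
      rw [integral_map (by fun_prop) (by fun_prop), integral_map (by fun_prop) (by fun_prop)]
      exact integral_add (hT₁ n m) (hT₂ n m)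
    rw [aux, aux, h₁, h₂]
  have hbound (n : ℕ) : ∫ z, ‖S n z‖ ∂q ≤
      2 * ∫ z, max (φ z.1 + ψ z.2) 0 ∂q + ∫ z, ‖φ z.1 + ψ z.2‖ ∂p := by
    have e : ∫ z, ‖S n z‖ ∂q ≤ ∫ z, (2 * max (φ z.1 + ψ z.2) 0 - S n z) ∂q := by
      refine integral_mono (hSi n q).norm ((hq.const_mul 2).sub (hSi n q)) fun z ↦ ?_
      have h := (hSle n z).2
      have h0 : ‖S n z‖ = 2 * max (S n z) 0 - S n z := by
        rw [Real.norm_eq_abs]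
        rcases abs_cases (S n z) with h | h <;> rcases max_cases (S n z) 0 with h' | h' <;> linarith
      simp only [h0]
      change max (S n z) 0 ≤ _ at h
      linarith
    rw [integral_sub (hq.const_mul 2) (hSi n q), integral_const_mul, hSeq] at e
    have e2 : -∫ z, S n z ∂p ≤ ∫ z, ‖φ z.1 + ψ z.2‖ ∂p := by
      rw [← integral_neg]
      exact integral_mono (hSi n p).neg hp.norm fun z ↦ (neg_le_abs _).trans (hSle n z).1
    linarith
  have hint : Integrable (fun z ↦ φ z.1 + ψ z.2) q := by
    refine ⟨by fun_prop, ?_⟩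
    refine lt_of_le_of_lt (?_ : _ ≤ ENNReal.ofReal
      (2 * ∫ z, max (φ z.1 + ψ z.2) 0 ∂q + ∫ z, ‖φ z.1 + ψ z.2‖ ∂p)) ENNReal.ofReal_lt_top
    calc ∫⁻ z, ‖φ z.1 + ψ z.2‖ₑ ∂q
        = ∫⁻ z, liminf (fun n ↦ ‖S n z‖ₑ) atTop ∂q :=
          lintegral_congr fun z ↦ (hSlim z).enorm.liminf_eq.symm
      _ ≤ liminf (fun n ↦ ∫⁻ z, ‖S n z‖ₑ ∂q) atTop :=
          lintegral_liminf_le fun n ↦ (hSm n).enorm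
      _ ≤ _ := by
          refine liminf_le_of_le (by isBoundedDefault) fun b hb ↦ ?_
          obtain ⟨n, hn⟩ := hb.exists
          refine hn.trans ?_
          rw [← ofReal_integral_norm_eq_lintegral_enorm (hSi n q)]
          exact ENNReal.ofReal_le_ofReal (hbound n)
  refine ⟨hint, ?_⟩
  have l (m : Measure (α × β)) [IsProbabilityMeasure m]
      (hm : Integrable (fun z ↦ φ z.1 + ψ z.2) m) :=
    tendsto_integral_of_dominated_convergence (F := S) (μ := m) _
      (fun n ↦ (hSm n).aestronglyMeasurable) hm.norm
      (fun n ↦ ae_of_all _ fun z ↦ (hSle n z).1) (ae_of_all _ hSlim)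
  refine tendsto_nhds_unique (l q hint) ?_
  simp_rw [hSeq]
  exact l p hp

end Truncation

section Perturbation

variable {α β : Type*} [MeasurableSpace α] [MeasurableSpace β]

/-- The pairing `((x, y), (x', y')) ↦ (x, y')`. -/
def crossLeft (w : (α × β) × α × β) : α × β := (w.1.1, w.2.2)

/-- The pairing `((x, y), (x', y')) ↦ (x', y)`. -/
def crossRight (w : (α × β) × α × β) : α × β := (w.2.1, w.1.2)

@[fun_prop]
lemma measurable_crossLeft : Measurable (crossLeft : (α × β) × α × β → α × β) := by
  unfold crossLeft
  fun_prop

@[fun_prop]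
lemma measurable_crossRight : Measurable (crossRight : (α × β) × α × β → α × β) := by
  unfold crossRight
  fun_prop

/-- If `π + σ₁ + σ₂ = π' + σ₃ + σ₄` and the perturbations cancel under `f`, then `π` and `π'` have
the same image under `f`. -/
lemma map_eq_map_of_add_eq {δ : Type*} [MeasurableSpace δ] {π π' : Measure (α × β)}
    {ρ : Measure ((α × β) × α × β)} [IsFiniteMeasure ρ] {p₁ p₂ p₃ p₄ : (α × β) × α × β → α × β}
    (hp₁ : Measurable p₁) (hp₂ : Measurable p₂) (hp₃ : Measurable p₃) (hp₄ : Measurable p₄)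
    (h : π' + (ρ.map p₃ + ρ.map p₄) = π + (ρ.map p₁ + ρ.map p₂)) {f : α × β → δ}
    (hf : Measurable f) (h₁ : f ∘ p₁ = f ∘ p₃) (h₂ : f ∘ p₂ = f ∘ p₄) :
    π'.map f = π.map f := by
  have e := congrArg (Measure.map f) h
  simp only [Measure.map_add _ _ hf, Measure.map_map hf hp₁, Measure.map_map hf hp₂,
    Measure.map_map hf hp₃, Measure.map_map hf hp₄, h₁, h₂] at e
  exact (Measure.add_left_inj _ _ _).1 e

/-- Moving mass along `ρ` from the pairs `(x, y')`, `(x', y)` to the pairs `(x, y)`, `(x', y')`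
decreases the entropy if the density satisfies `Z(x,y) Z(x',y') < Z(x,y') Z(x',y)` with some
room, `ρ`-almost everywhere. -/
lemma exists_relEnt_lt_of_swap {γ π : Measure (α × β)} [IsProbabilityMeasure γ]
    [IsProbabilityMeasure π] (hent : relEnt π γ ≠ ⊤) {Z : α × β → ℝ}
    (hZ : Z = fun z ↦ (π.rnDeriv γ z).toReal) {ε : ℝ} (hε : 0 < ε)
    {ρ : Measure ((α × β) × α × β)} [IsFiniteMeasure ρ] (hρ : ρ ≠ 0)
    (h₁ : ρ.map Prod.fst ≤ ENNReal.ofReal (ε / 2) • γ)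
    (h₂ : ρ.map Prod.snd ≤ ENNReal.ofReal (ε / 2) • γ)
    (h₃ : ρ.map crossLeft ≤ ENNReal.ofReal (ε / 2) • γ)
    (h₄ : ρ.map crossRight ≤ ENNReal.ofReal (ε / 2) • γ)
    (hl : ∀ᵐ w ∂ρ, 2 * ε ≤ Z (crossLeft w)) (hr : ∀ᵐ w ∂ρ, 2 * ε ≤ Z (crossRight w))
    (hlt : ∀ᵐ w ∂ρ, (Z w.1 + ε) * (Z w.2 + ε) < (Z (crossLeft w) - ε) * (Z (crossRight w) - ε)) :
    ∃ π' : Measure (α × β), IsProbabilityMeasure π' ∧ π'.map Prod.fst = π.map Prod.fst ∧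
      π'.map Prod.snd = π.map Prod.snd ∧ relEnt π' γ < relEnt π γ := by
  obtain ⟨hac, -, hkl, hkl_eq⟩ := integrable_klFun_of_relEnt_ne_top hent
  have hZm : Measurable Z := by rw [hZ]; fun_prop
  have hZ0 (z) : 0 ≤ Z z := by rw [hZ]; exact ENNReal.toReal_nonneg
  have hZi : Integrable Z γ := by rw [hZ]; exact Measure.integrable_toReal_rnDeriv
  have hπ : π = γ.withDensity fun z ↦ ENNReal.ofReal (Z z) := by
    conv_lhs => rw [← Measure.withDensity_rnDeriv_eq π γ hac]
    refine withDensity_congr_ae ?_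
    filter_upwards [Measure.rnDeriv_lt_top π γ] with z hz
    rw [hZ, ENNReal.ofReal_toReal hz.ne]
  have hε2 : 0 ≤ ε / 2 := by positivity
  obtain ⟨k₁, m₁, n₁, b₁, e₁⟩ := exists_density_of_le_smul hε2 h₁
  obtain ⟨k₂, m₂, n₂, b₂, e₂⟩ := exists_density_of_le_smul hε2 h₂
  obtain ⟨k₃, m₃, n₃, b₃, e₃⟩ := exists_density_of_le_smul hε2 h₃
  obtain ⟨k₄, m₄, n₄, b₄, e₄⟩ := exists_density_of_le_smul hε2 h₄
  have supp {p : (α × β) × α × β → α × β} (hp : Measurable p) {k : α × β → ℝ}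
      (hk : Measurable k) (e : ρ.map p = γ.withDensity fun z ↦ ENNReal.ofReal (k z))
      (h : ∀ᵐ w ∂ρ, 2 * ε ≤ Z (p w)) : ∀ᵐ z ∂γ, 0 < k z → 2 * ε ≤ Z z := by
    have h' : ∀ᵐ z ∂(ρ.map p), 2 * ε ≤ Z z :=
      (ae_map_iff hp.aemeasurable (measurableSet_le measurable_const hZm)).2 h
    rw [e, ae_withDensity_iff (by fun_prop)] at h'
    filter_upwards [h'] with z hz hkz
    exact hz (by simpa using hkz)
  let Z' : α × β → ℝ := fun z ↦ Z z + (k₁ z + k₂ z) - (k₃ z + k₄ z)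
  have hZ'm : Measurable Z' := by fun_prop
  have hZ'le (z) : Z' z ≤ Z z + ε := by
    simp only [Z']; linarith [b₁ z, b₂ z, n₃ z, n₄ z]
  have hZ'ge (z) : Z z - ε ≤ Z' z := by
    simp only [Z']; linarith [n₁ z, n₂ z, b₃ z, b₄ z]
  let u : α × β → ℝ := fun z ↦ Real.log (max ε (Z' z))
  have hum : Measurable u := by fun_prop
  have key : ∀ᵐ z ∂γ, 0 ≤ Z' z ∧ klFun (Z' z) ≤ klFun (Z z) +
      (k₁ z * u z + k₂ z * u z - (k₃ z * u z + k₄ z * u z)) := by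
    filter_upwards [supp measurable_crossLeft m₃ e₃ hl, supp measurable_crossRight m₄ e₄ hr]
      with z hz₃ hz₄
    have hd : k₁ z * u z + k₂ z * u z - (k₃ z * u z + k₄ z * u z) = (Z' z - Z z) * u z := by
      simp only [Z']; ring
    rw [hd]
    by_cases hk : 0 < k₃ z ∨ 0 < k₄ z
    · have hz : 2 * ε ≤ Z z := hk.elim hz₃ hz₄
      have hz' : ε ≤ Z' z := by linarith [hZ'ge z]
      have := klFun_add_mul_log_le (hZ0 z) (hε.trans_le hz')
      refine ⟨by linarith, ?_⟩
      simp only [u, max_eq_right hz']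
      linarith
    · have hz' : Z z ≤ Z' z := by
        simp only [Z']; push Not at hk; linarith [n₁ z, n₂ z]
      refine ⟨(hZ0 z).trans hz', ?_⟩
      rcases ((hZ0 z).trans hz').eq_or_lt with h0 | h0
      · have : Z z = 0 := le_antisymm (by linarith) (hZ0 z)
        rw [← h0, this]; simp
      · have := klFun_add_mul_log_le (hZ0 z) h0
        have hlog : Real.log (Z' z) ≤ u z := Real.log_le_log h0 (le_max_right _ _)
        nlinarith
  let π' : Measure (α × β) := γ.withDensity fun z ↦ ENNReal.ofReal (Z' z)
  have hsum : π' + (ρ.map crossLeft + ρ.map crossRight) =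
      π + (ρ.map Prod.fst + ρ.map Prod.snd) := by
    rw [e₁, e₂, e₃, e₄]
    conv_rhs => rw [hπ]
    simp only [π']
    rw [← withDensity_add_left (by fun_prop), ← withDensity_add_left (by fun_prop),
      ← withDensity_add_left (by fun_prop), ← withDensity_add_left (by fun_prop)]
    refine withDensity_congr_ae ?_
    filter_upwards [key] with z hz
    simp only [Pi.add_apply]
    rw [← ENNReal.ofReal_add (n₃ z) (n₄ z), ← ENNReal.ofReal_add (n₁ z) (n₂ z),
      ← ENNReal.ofReal_add hz.1 (add_nonneg (n₃ z) (n₄ z)),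
      ← ENNReal.ofReal_add (hZ0 z) (add_nonneg (n₁ z) (n₂ z))]
    congr 1
    simp only [Z']; ring
  have hfst : π'.map Prod.fst = π.map Prod.fst :=
    map_eq_map_of_add_eq measurable_fst measurable_snd measurable_crossLeft
      measurable_crossRight hsum measurable_fst rfl rfl
  have hsum' : π' + (ρ.map crossRight + ρ.map crossLeft) =
      π + (ρ.map Prod.fst + ρ.map Prod.snd) := by
    rw [← hsum, add_comm (ρ.map crossRight)]
  have hsnd : π'.map Prod.snd = π.map Prod.snd :=
    map_eq_map_of_add_eq measurable_fst measurable_snd measurable_crossRight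
      measurable_crossLeft hsum' measurable_snd rfl rfl
  have hπ'prob : IsProbabilityMeasure π' := by
    refine ⟨?_⟩
    have := congrArg (fun m ↦ m Set.univ) hfst
    simpa [Measure.map_apply measurable_fst MeasurableSet.univ] using this
  refine ⟨π', hπ'prob, hfst, hsnd, ?_⟩
  have hui : Integrable u γ := by
    refine Integrable.mono' (((integrable_const |Real.log ε|).add hZi).add (integrable_const ε))
      hum.aestronglyMeasurable (ae_of_all _ fun z ↦ ?_)
    have hpos : 0 < max ε (Z' z) := lt_max_of_lt_left hε
    have hlow : Real.log ε ≤ u z := Real.log_le_log hε (le_max_left _ _)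
    have hup : u z ≤ max ε (Z' z) := (Real.log_le_sub_one_of_pos hpos).trans (by linarith)
    have hmax : max ε (Z' z) ≤ Z z + ε := max_le (by linarith [hZ0 z]) (hZ'le z)
    simp only [Pi.add_apply]
    rw [Real.norm_eq_abs, abs_le]
    constructor <;> linarith [neg_abs_le (Real.log ε), abs_nonneg (Real.log ε), hZ0 z]
  have hki {k : α × β → ℝ} (m : Measurable k) (n : ∀ z, 0 ≤ k z) (b : ∀ z, k z ≤ ε / 2) :
      Integrable (fun z ↦ k z * u z) γ := by
    refine hui.bdd_mul m.aestronglyMeasurable (c := ε / 2) (ae_of_all _ fun z ↦ ?_)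
    rw [Real.norm_eq_abs, abs_of_nonneg (n z)]
    exact b z
  have i₁ := hki m₁ n₁ b₁
  have i₂ := hki m₂ n₂ b₂
  have i₃ := hki m₃ n₃ b₃
  have i₄ := hki m₄ n₄ b₄
  have transfer {p : (α × β) × α × β → α × β} (hp : Measurable p) {k : α × β → ℝ}
      (m : Measurable k) (n : ∀ z, 0 ≤ k z)
      (e : ρ.map p = γ.withDensity fun z ↦ ENNReal.ofReal (k z))
      (i : Integrable (fun z ↦ k z * u z) γ) :
      Integrable (fun w ↦ u (p w)) ρ ∧ ∫ z, k z * u z ∂γ = ∫ w, u (p w) ∂ρ := by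
    rw [← integral_withDensity_ofReal m n, ← e,
      integral_map hp.aemeasurable hum.aestronglyMeasurable]
    rw [← integrable_withDensity_ofReal_iff m n, ← e] at i
    exact ⟨i.comp_measurable hp, rfl⟩
  obtain ⟨j₁, t₁⟩ := transfer measurable_fst m₁ n₁ e₁ i₁
  obtain ⟨j₂, t₂⟩ := transfer measurable_snd m₂ n₂ e₂ i₂
  obtain ⟨j₃, t₃⟩ := transfer measurable_crossLeft m₃ n₃ e₃ i₃
  obtain ⟨j₄, t₄⟩ := transfer measurable_crossRight m₄ n₄ e₄ i₄
  have hneg : ∫ z, (k₁ z * u z + k₂ z * u z - (k₃ z * u z + k₄ z * u z)) ∂γ < 0 := by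
    rw [integral_sub (by exact i₁.add i₂) (by exact i₃.add i₄), integral_add i₁ i₂,
      integral_add i₃ i₄, t₁, t₂, t₃, t₄, ← integral_add j₁ j₂, ← integral_add j₃ j₄, sub_neg]
    have hw : ∀ᵐ w ∂ρ, u w.1 + u w.2 < u (crossLeft w) + u (crossRight w) := by
      filter_upwards [hl, hr, hlt] with w hwl hwr hw
      have pos (z) : 0 < max ε (Z' z) := lt_max_of_lt_left hε
      have up (z) : max ε (Z' z) ≤ Z z + ε := max_le (by linarith [hZ0 z]) (hZ'le z)
      have low (z) : Z z - ε ≤ max ε (Z' z) := (hZ'ge z).trans (le_max_right _ _)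
      simp only [u]
      rw [← Real.log_mul (pos _).ne' (pos _).ne', ← Real.log_mul (pos _).ne' (pos _).ne']
      refine Real.log_lt_log (mul_pos (pos _) (pos _)) ?_
      calc _ ≤ (Z w.1 + ε) * (Z w.2 + ε) :=
            mul_le_mul (up _) (up _) (pos _).le (by linarith [hZ0 w.1])
        _ < _ := hw
        _ ≤ _ := mul_le_mul (low _) (low _) (by linarith) (pos _).le
    refine lt_of_le_of_ne (integral_mono_ae (j₁.add j₂) (j₃.add j₄) (hw.mono fun w h ↦ h.le))
      fun heq ↦ hρ ?_
    have h0 := (integral_eq_iff_of_ae_le (j₁.add j₂) (j₃.add j₄) (hw.mono fun w h ↦ h.le)).1 heq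
    rw [← ae_eq_bot, ← eventually_false_iff_eq_bot]
    filter_upwards [hw, h0] with w a b
    exact a.ne b
  have hrn : ∀ᵐ z ∂γ, (π'.rnDeriv γ z).toReal = Z' z := by
    filter_upwards [Measure.rnDeriv_withDensity γ (f := fun z ↦ ENNReal.ofReal (Z' z))
      (by fun_prop), key] with z hz hk
    rw [hz, ENNReal.toReal_ofReal hk.1]
  have hsi := (i₁.add i₂).sub (i₃.add i₄)
  have hklZ : Integrable (fun z ↦ klFun (Z z)) γ := by rw [hZ]; exact hkl
  have hbd := hklZ.add hsi
  have hkl' : Integrable (fun z ↦ klFun (Z' z)) γ := by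
    refine Integrable.mono' hbd (by fun_prop) ?_
    filter_upwards [key] with z hz
    rw [Real.norm_eq_abs, abs_of_nonneg (klFun_nonneg hz.1)]
    exact hz.2
  have hlt_int : ∫ z, klFun (Z' z) ∂γ < ∫ z, klFun (Z z) ∂γ := by
    have := integral_mono_ae hkl' hbd (key.mono fun z hz ↦ hz.2)
    rw [integral_add' hklZ hsi] at this
    simp only [Pi.add_apply, Pi.sub_apply] at this
    linarith
  have hac' : π' ≪ γ := withDensity_absolutelyContinuous _ _
  have hllr : Integrable (llr π' γ) π' := by
    rw [← integrable_klFun_rnDeriv_iff hac']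
    exact hkl'.congr (hrn.mono fun z hz ↦ by simp only [hz])
  have hrel : relEnt π' γ = ENNReal.ofReal (∫ z, klFun (Z' z) ∂γ) := by
    rw [relEnt_eq_klDiv, klDiv_eq_integral_klFun, if_pos ⟨hac', hllr⟩]
    congr 1
    exact integral_congr_ae (hrn.mono fun z hz ↦ by simp only [hz])
  have hrel0 : relEnt π γ = ENNReal.ofReal (∫ z, klFun (Z z) ∂γ) := by rw [hkl_eq, hZ]
  have hnn : 0 ≤ ∫ z, klFun (Z' z) ∂γ :=
    integral_nonneg_of_ae (key.mono fun z hz ↦ klFun_nonneg hz.1)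
  rw [hrel, hrel0]
  exact (ENNReal.ofReal_lt_ofReal_iff (hnn.trans_lt hlt_int)).2 hlt_int

end Perturbation

section Optimality

variable {α β : Type*} [MeasurableSpace α] [MeasurableSpace β]

lemma measurePreserving_crossLeft (μ : Measure α) (ν : Measure β) [IsProbabilityMeasure μ]
    [IsProbabilityMeasure ν] :
    MeasurePreserving crossLeft ((μ.prod ν).prod (μ.prod ν)) (μ.prod ν) :=
  measurePreserving_fst.prod measurePreserving_snd

lemma measurePreserving_crossRight (μ : Measure α) (ν : Measure β) [IsProbabilityMeasure μ]
    [IsProbabilityMeasure ν] :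
    MeasurePreserving crossRight ((μ.prod ν).prod (μ.prod ν)) (μ.prod ν) :=
  Measure.measurePreserving_swap.comp (measurePreserving_snd.prod measurePreserving_fst)

lemma measurePreserving_cross (μ : Measure α) (ν : Measure β) [IsProbabilityMeasure μ]
    [IsProbabilityMeasure ν] :
    MeasurePreserving (fun w ↦ (crossLeft w, crossRight w)) ((μ.prod ν).prod (μ.prod ν))
      ((μ.prod ν).prod (μ.prod ν)) := by
  have hrev : MeasurePreserving (fun v : β × α × β ↦ (v.2.2, v.2.1, v.1))
      (ν.prod (μ.prod ν)) (ν.prod (μ.prod ν)) :=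
    ((MeasurePreserving.id ν).prod Measure.measurePreserving_swap).comp
      (Measure.measurePreserving_swap.comp (measurePreserving_prodAssoc ν μ ν).symm)
  exact (measurePreserving_prodAssoc μ ν (μ.prod ν)).symm.comp
    (((MeasurePreserving.id μ).prod hrev).comp (measurePreserving_prodAssoc μ ν (μ.prod ν)))

/-- If no measure with the marginals of `π` has smaller entropy, then the density of `π` satisfies
a cross-product inequality. -/
lemma ae_mul_le_mul_of_forall_le {μ : Measure α} {ν : Measure β} {γ π : Measure (α × β)}
    [IsProbabilityMeasure μ] [IsProbabilityMeasure ν] [IsProbabilityMeasure γ]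
    [IsProbabilityMeasure π] (hγ : μ.prod ν ≪ γ) (hent : relEnt π γ ≠ ⊤)
    (hopt : ∀ π' : Measure (α × β), IsProbabilityMeasure π' → π'.map Prod.fst = π.map Prod.fst →
      π'.map Prod.snd = π.map Prod.snd → relEnt π γ ≤ relEnt π' γ)
    {Z : α × β → ℝ} (hZ : Z = fun z ↦ (π.rnDeriv γ z).toReal) :
    ∀ᵐ w ∂((μ.prod ν).prod (μ.prod ν)),
      Z (crossLeft w) * Z (crossRight w) ≤ Z w.1 * Z w.2 := by
  have hZm : Measurable Z := by rw [hZ]; fun_prop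
  have hZ0 (z) : 0 ≤ Z z := by rw [hZ]; exact ENNReal.toReal_nonneg
  set m := μ.prod ν with hm
  let L := m.rnDeriv γ
  have hLm : Measurable L := Measure.measurable_rnDeriv _ _
  have q₁ : MeasurePreserving Prod.fst (m.prod m) m := measurePreserving_fst
  have q₂ : MeasurePreserving Prod.snd (m.prod m) m := measurePreserving_snd
  have q₃ : MeasurePreserving crossLeft (m.prod m) m := measurePreserving_crossLeft μ ν
  have q₄ : MeasurePreserving crossRight (m.prod m) m := measurePreserving_crossRight μ ν
  let e : ℕ → ℝ := fun n ↦ 1 / ((n : ℝ) + 1)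
  have he (n : ℕ) : 0 < e n := Nat.one_div_pos_of_nat
  let B : ℕ → Set ((α × β) × α × β) := fun n ↦
    {w | (L w.1 ≤ n ∧ L w.2 ≤ n ∧ L (crossLeft w) ≤ n ∧ L (crossRight w) ≤ n) ∧
      2 * e n ≤ Z (crossLeft w) ∧ 2 * e n ≤ Z (crossRight w) ∧
      (Z w.1 + e n) * (Z w.2 + e n) < (Z (crossLeft w) - e n) * (Z (crossRight w) - e n)}
  have hB (n : ℕ) : MeasurableSet (B n) := by
    simp only [B, Set.ofPred_and]
    refine ((measurableSet_le (by fun_prop) (by fun_prop)).inter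
      ((measurableSet_le (by fun_prop) (by fun_prop)).inter
      ((measurableSet_le (by fun_prop) (by fun_prop)).inter
      (measurableSet_le (by fun_prop) (by fun_prop))))).inter
      ((measurableSet_le (by fun_prop) (by fun_prop)).inter
      ((measurableSet_le (by fun_prop) (by fun_prop)).inter
      (measurableSet_lt (by fun_prop) (by fun_prop))))
  have hnull (n : ℕ) : (m.prod m) (B n) = 0 := by
    by_contra hne
    let c : ℝ := e n / 2 * e n
    have hc : 0 < c := mul_pos (half_pos (he n)) (he n)
    let ρ := ENNReal.ofReal c • (m.prod m).restrict (B n)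
    have hρae {P : (α × β) × α × β → Prop} (h : ∀ w ∈ B n, P w) : ∀ᵐ w ∂ρ, P w :=
      Measure.ae_smul_measure ((ae_restrict_iff' (hB n)).2 (ae_of_all _ h)) _
    have hfinite : IsFiniteMeasure ρ :=
      Measure.smul_finite _ ENNReal.ofReal_ne_top
    have hρ0 : ρ ≠ 0 := by
      intro h
      have := congrArg (fun k ↦ k Set.univ) h
      simp only [ρ, Measure.smul_apply, Measure.restrict_apply_univ, smul_eq_mul,
        Measure.coe_zero, Pi.zero_apply, mul_eq_zero, ENNReal.ofReal_eq_zero, not_le.2 hc,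
        false_or] at this
      exact hne this
    have hle {p : (α × β) × α × β → α × β} (hp : MeasurePreserving p (m.prod m) m)
        (hpL : ∀ w ∈ B n, L (p w) ≤ n) : ρ.map p ≤ ENNReal.ofReal (e n / 2) • γ := by
      refine Measure.le_intro fun s hs _ ↦ ?_
      rw [Measure.map_apply hp.measurable hs]
      simp only [ρ, Measure.smul_apply, smul_eq_mul]
      have h1 : (m.prod m).restrict (B n) (p ⁻¹' s) ≤ n * γ s := by
        have hs' : MeasurableSet (s ∩ {z | L z ≤ n}) :=
          hs.inter (measurableSet_le hLm measurable_const)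
        calc (m.prod m).restrict (B n) (p ⁻¹' s)
            = (m.prod m) (p ⁻¹' s ∩ B n) := Measure.restrict_apply (hp.measurable hs)
          _ ≤ (m.prod m) (p ⁻¹' (s ∩ {z | L z ≤ n})) :=
              measure_mono fun w hw ↦ ⟨hw.1, hpL w hw.2⟩
          _ = m (s ∩ {z | L z ≤ n}) := hp.measure_preimage hs'.nullMeasurableSet
          _ = ∫⁻ z in s ∩ {z | L z ≤ n}, L z ∂γ := (Measure.setLIntegral_rnDeriv hγ _).symm
          _ ≤ ∫⁻ z in s ∩ {z | L z ≤ n}, n ∂γ := setLIntegral_mono measurable_const fun z hz ↦ hz.2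
          _ = n * γ (s ∩ {z | L z ≤ n}) := setLIntegral_const _ _
          _ ≤ n * γ s := by gcongr; exact Set.inter_subset_left
      calc ENNReal.ofReal c * (m.prod m).restrict (B n) (p ⁻¹' s)
          ≤ ENNReal.ofReal c * (n * γ s) := by gcongr
        _ = ENNReal.ofReal (c * n) * γ s := by
            rw [← mul_assoc, ENNReal.ofReal_mul hc.le, ENNReal.ofReal_natCast]
        _ ≤ ENNReal.ofReal (e n / 2) * γ s := by
            gcongr
            have : e n * n ≤ 1 := by
              simp only [e]
              rw [one_div_mul_eq_div, div_le_one (by positivity)]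
              linarith
            calc c * n = e n / 2 * (e n * n) := by simp only [c]; ring
              _ ≤ e n / 2 * 1 := by gcongr
              _ = e n / 2 := mul_one _
    obtain ⟨π', hp, hf, hs, hlt⟩ := exists_relEnt_lt_of_swap hent hZ (he n) hρ0
      (hle q₁ fun w hw ↦ hw.1.1) (hle q₂ fun w hw ↦ hw.1.2.1) (hle q₃ fun w hw ↦ hw.1.2.2.1)
      (hle q₄ fun w hw ↦ hw.1.2.2.2) (hρae fun w hw ↦ hw.2.1) (hρae fun w hw ↦ hw.2.2.1)
      (hρae fun w hw ↦ hw.2.2.2)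
    exact (hopt π' hp hf hs).not_gt hlt
  have hLfin : ∀ᵐ z ∂m, L z < ⊤ := hγ.ae_le (Measure.rnDeriv_lt_top m γ)
  have hBae : ∀ᵐ w ∂(m.prod m), ∀ n, w ∉ B n :=
    ae_all_iff.2 fun n ↦ measure_eq_zero_iff_ae_notMem.1 (hnull n)
  filter_upwards [hBae, q₁.quasiMeasurePreserving.ae hLfin, q₂.quasiMeasurePreserving.ae hLfin,
    q₃.quasiMeasurePreserving.ae hLfin, q₄.quasiMeasurePreserving.ae hLfin] with w hw l₁ l₂ l₃ l₄
  by_contra! hlt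
  have hpos : 0 < Z (crossLeft w) * Z (crossRight w) :=
    (mul_nonneg (hZ0 _) (hZ0 _)).trans_lt hlt
  have hpos₃ : 0 < Z (crossLeft w) := pos_of_mul_pos_left hpos (hZ0 _)
  have hpos₄ : 0 < Z (crossRight w) := pos_of_mul_pos_right hpos (hZ0 _)
  have he0 : Tendsto e atTop (𝓝 0) := tendsto_one_div_add_atTop_nhds_zero_nat
  have hL {z} (h : L z < ⊤) : ∀ᶠ n : ℕ in atTop, L z ≤ n := by
    obtain ⟨N, hN⟩ := ENNReal.exists_nat_gt h.ne
    filter_upwards [eventually_ge_atTop N] with n hn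
    exact hN.le.trans (by exact_mod_cast hn)
  have hsmall {z} (h : 0 < Z z) : ∀ᶠ n : ℕ in atTop, 2 * e n ≤ Z z := by
    have : Tendsto (fun n ↦ 2 * e n) atTop (𝓝 (2 * 0)) := he0.const_mul 2
    rw [mul_zero] at this
    exact (this.eventually_lt_const h).mono fun n hn ↦ hn.le
  have hlim : ∀ᶠ n in atTop, (Z w.1 + e n) * (Z w.2 + e n) <
      (Z (crossLeft w) - e n) * (Z (crossRight w) - e n) := by
    refine Tendsto.eventually_lt
      ((tendsto_const_nhds.add he0).mul (tendsto_const_nhds.add he0))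
      ((tendsto_const_nhds.sub he0).mul (tendsto_const_nhds.sub he0)) ?_
    simpa using hlt
  obtain ⟨n, hn⟩ := ((((hL l₁).and ((hL l₂).and ((hL l₃).and (hL l₄))))).and
    ((hsmall hpos₃).and ((hsmall hpos₄).and hlim))).exists
  exact hw n hn

/-- The density of an optimizer has product form. -/
lemma exists_mul_of_forall_le {μ : Measure α} {ν : Measure β} {γ π : Measure (α × β)}
    [IsProbabilityMeasure μ] [IsProbabilityMeasure ν] [IsProbabilityMeasure γ]
    [IsProbabilityMeasure π] (hγ₁ : γ ≪ μ.prod ν) (hγ₂ : μ.prod ν ≪ γ) (hent : relEnt π γ ≠ ⊤)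
    (hopt : ∀ π' : Measure (α × β), IsProbabilityMeasure π' → π'.map Prod.fst = π.map Prod.fst →
      π'.map Prod.snd = π.map Prod.snd → relEnt π γ ≤ relEnt π' γ) :
    ∃ f : α → ℝ, ∃ g : β → ℝ, Measurable f ∧ Measurable g ∧
      ∀ᵐ z ∂γ, (π.rnDeriv γ z).toReal = f z.1 * g z.2 := by
  let Z : α × β → ℝ := fun z ↦ (π.rnDeriv γ z).toReal
  have hZm : Measurable Z := by fun_prop
  have hle := ae_mul_le_mul_of_forall_le hγ₂ hent hopt (Z := Z) rfl
  have hle' := (measurePreserving_cross μ ν).quasiMeasurePreserving.ae hle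
  have heq : ∀ᵐ w ∂((μ.prod ν).prod (μ.prod ν)),
      Z (crossLeft w) * Z (crossRight w) = Z w.1 * Z w.2 := by
    filter_upwards [hle, hle'] with w h h'
    exact le_antisymm h h'
  have hac : π ≪ γ := (integrable_klFun_of_relEnt_ne_top hent).1
  have hpos : ∀ᵐ z ∂π, Z z ≠ 0 := by
    filter_upwards [Measure.rnDeriv_pos hac, hac.ae_le (Measure.rnDeriv_lt_top π γ)] with z h h'
    exact (ENNReal.toReal_pos h.ne' h'.ne).ne'
  have hsec : ∀ᵐ z₀ ∂π, ∀ᵐ z ∂(μ.prod ν),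
      Z (crossLeft (z₀, z)) * Z (crossRight (z₀, z)) = Z z₀ * Z z :=
    (hac.trans hγ₁).ae_le (Measure.ae_ae_of_ae_prod heq)
  obtain ⟨z₀, h₀, hne⟩ := (hsec.and hpos).exists
  refine ⟨fun x ↦ Z (x, z₀.2), fun y ↦ Z (z₀.1, y) / Z z₀, by fun_prop, by fun_prop, ?_⟩
  filter_upwards [hγ₁.ae_le h₀] with z hz
  change Z z = Z (z.1, z₀.2) * (Z (z₀.1, z.2) / Z z₀)
  rw [← mul_div_assoc, eq_div_iff hne, mul_comm (Z z), ← hz, mul_comm]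
  rfl

/-- A measure with finite entropy whose density has product form minimizes the entropy among the
measures with the same marginals. -/
lemma relEnt_le_of_rnDeriv_eq_mul {γ π π' : Measure (α × β)} [IsProbabilityMeasure γ]
    [IsProbabilityMeasure π] [IsProbabilityMeasure π'] (h₁ : π.map Prod.fst = π'.map Prod.fst)
    (h₂ : π.map Prod.snd = π'.map Prod.snd)
    (hγ : γ ≪ (π.map Prod.fst).prod (π.map Prod.snd)) (hent : relEnt π γ ≠ ⊤)
    {f : α → ℝ} {g : β → ℝ} (hf : Measurable f) (hg : Measurable g)
    (hfg : ∀ᵐ z ∂γ, (π.rnDeriv γ z).toReal = f z.1 * g z.2) :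
    relEnt π γ ≤ relEnt π' γ := by
  by_cases hent' : relEnt π' γ = ⊤
  · simp [hent']
  obtain ⟨hac, hllr, hkl, hkl_eq⟩ := integrable_klFun_of_relEnt_ne_top hent
  obtain ⟨hac', -, hkl', hkl_eq'⟩ := integrable_klFun_of_relEnt_ne_top hent'
  have hposπ : ∀ᵐ z ∂π, f z.1 ≠ 0 ∧ g z.2 ≠ 0 := by
    filter_upwards [Measure.rnDeriv_pos hac, hac.ae_le (Measure.rnDeriv_lt_top π γ),
      hac.ae_le hfg] with z h h' hz
    have := (ENNReal.toReal_pos h.ne' h'.ne).ne'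
    rw [hz] at this
    exact mul_ne_zero_iff.1 this
  have hf0 : ∀ᵐ x ∂(π.map Prod.fst), f x ≠ 0 :=
    (ae_map_iff measurable_fst.aemeasurable (hf (measurableSet_singleton 0).compl)).2
      (hposπ.mono fun z h ↦ h.1)
  have hg0 : ∀ᵐ y ∂(π.map Prod.snd), g y ≠ 0 :=
    (ae_map_iff measurable_snd.aemeasurable (hg (measurableSet_singleton 0).compl)).2
      (hposπ.mono fun z h ↦ h.2)
  have : IsProbabilityMeasure (π.map Prod.fst) :=
    Measure.isProbabilityMeasure_map measurable_fst.aemeasurable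
  have : IsProbabilityMeasure (π.map Prod.snd) :=
    Measure.isProbabilityMeasure_map measurable_snd.aemeasurable
  let S : α × β → ℝ := fun z ↦ Real.log (f z.1) + Real.log (g z.2)
  have hSm : Measurable S := by fun_prop
  have hZ : ∀ᵐ z ∂γ, 0 < (π.rnDeriv γ z).toReal ∧ Real.log (π.rnDeriv γ z).toReal = S z := by
    filter_upwards [hfg, hγ.ae_le (Measure.quasiMeasurePreserving_fst.ae hf0),
      hγ.ae_le (Measure.quasiMeasurePreserving_snd.ae hg0)] with z hz hfz hgz
    refine ⟨lt_of_le_of_ne ENNReal.toReal_nonneg ?_, ?_⟩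
    · rw [hz]
      exact (mul_ne_zero hfz hgz).symm
    · rw [hz, Real.log_mul hfz hgz]
  have hllrS : llr π γ =ᵐ[π] S := by
    filter_upwards [hac.ae_le hZ] with z hz
    rw [llr, hz.2]
  have key : ∀ᵐ z ∂γ, (π'.rnDeriv γ z).toReal * S z + 1 - (π.rnDeriv γ z).toReal ≤
      klFun (π'.rnDeriv γ z).toReal := by
    filter_upwards [hZ] with z hz
    have := klFun_add_mul_log_le (a := (π'.rnDeriv γ z).toReal) ENNReal.toReal_nonneg hz.1
    rw [hz.2] at this
    rw [klFun_apply (π.rnDeriv γ z).toReal, hz.2] at this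
    linarith
  have hSpos : Integrable (fun z ↦ max (S z) 0) π' := by
    rw [← integrable_rnDeriv_smul_iff hac']
    refine Integrable.mono' (hkl'.add (Measure.integrable_toReal_rnDeriv (μ := π) (ν := γ)))
      (by fun_prop) ?_
    filter_upwards [key] with z hz
    have h0 : 0 ≤ (π'.rnDeriv γ z).toReal := ENNReal.toReal_nonneg
    have h1 : 0 ≤ (π.rnDeriv γ z).toReal := ENNReal.toReal_nonneg
    have h2 := klFun_nonneg h0
    simp only [Pi.add_apply, smul_eq_mul]
    rw [Real.norm_of_nonneg (mul_nonneg h0 (le_max_right _ _))]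
    rcases max_cases (S z) 0 with ⟨h, -⟩ | ⟨h, -⟩ <;> rw [h] <;> linarith
  obtain ⟨hSi, hSeq⟩ := integral_add_eq_of_map_eq h₁ h₂ (Real.measurable_log.comp hf)
    (Real.measurable_log.comp hg) (hllr.congr hllrS) hSpos
  have hSi' : Integrable (fun z ↦ (π'.rnDeriv γ z).toReal * S z) γ :=
    (integrable_rnDeriv_smul_iff hac').2 hSi
  rw [hkl_eq, hkl_eq']
  refine ENNReal.ofReal_le_ofReal ?_
  have hi := hSi'.add (integrable_const (1 : ℝ))
  have hZi : Integrable (fun z ↦ (π.rnDeriv γ z).toReal) γ := Measure.integrable_toReal_rnDeriv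
  calc ∫ z, klFun (π.rnDeriv γ z).toReal ∂γ = ∫ z, S z ∂π := by
        rw [integral_klFun_rnDeriv hac hllr, integral_congr_ae hllrS]
        simp
    _ = ∫ z, S z ∂π' := hSeq.symm
    _ = ∫ z, (π'.rnDeriv γ z).toReal * S z + 1 - (π.rnDeriv γ z).toReal ∂γ := by
        rw [integral_sub (by exact hi) hZi, integral_add hSi' (integrable_const _),
          Measure.integral_toReal_rnDeriv hac, ← integral_rnDeriv_smul hac']
        simp
    _ ≤ ∫ z, klFun (π'.rnDeriv γ z).toReal ∂γ := integral_mono_ae (hi.sub hZi) hkl' key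

end Optimality

/-- Characterization of optimizers of the Schrödinger (entropic optimal transport) problem:
a coupling is optimal iff it has finite entropy and its density w.r.t. `γ` has product form. -/
theorem schroedinger_optimizer_characterization
    (μ : ProbabilityMeasure X) (ν : ProbabilityMeasure Y)
    (γ : ProbabilityMeasure (X × Y))
    (hγ₁ : (γ : Measure (X × Y)) ≪ (μ : Measure X).prod (ν : Measure Y))
    (hγ₂ : (μ : Measure X).prod (ν : Measure Y) ≪ (γ : Measure (X × Y)))
    (hfin : (⨅ (π : ProbabilityMeasure (X × Y)) (_ : IsCoupling μ ν π),
        relEnt (π : Measure (X × Y)) (γ : Measure (X × Y))) ≠ ⊤)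
    (π : ProbabilityMeasure (X × Y)) (hπ : IsCoupling μ ν π) :
    (∀ π' : ProbabilityMeasure (X × Y), IsCoupling μ ν π' →
        relEnt (π : Measure (X × Y)) (γ : Measure (X × Y)) ≤
          relEnt (π' : Measure (X × Y)) (γ : Measure (X × Y))) ↔
      (relEnt (π : Measure (X × Y)) (γ : Measure (X × Y)) ≠ ⊤ ∧
        ∃ f : X → ℝ, ∃ g : Y → ℝ, Measurable f ∧ Measurable g ∧
          ∀ᵐ z ∂(γ : Measure (X × Y)),
            ((π : Measure (X × Y)).rnDeriv (γ : Measure (X × Y)) z).toReal =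
              f z.1 * g z.2) := by
  constructor
  · intro hopt
    have hent : relEnt (π : Measure (X × Y)) (γ : Measure (X × Y)) ≠ ⊤ :=
      ne_top_of_le_ne_top hfin (le_iInf₂ hopt)
    refine ⟨hent, exists_mul_of_forall_le hγ₁ hγ₂ hent fun π' hp h₁ h₂ ↦ ?_⟩
    exact hopt ⟨π', hp⟩ ⟨h₁.trans hπ.1, h₂.trans hπ.2⟩
  · rintro ⟨hent, f, g, hf, hg, hfg⟩ π' hπ'
    refine relEnt_le_of_rnDeriv_eq_mul (hπ.1.trans hπ'.1.symm) (hπ.2.trans hπ'.2.symm) ?_ hent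
      hf hg hfg
    rwa [hπ.1, hπ.2]

end
end
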